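/- For every real number k with (√41 − 5)/8 < k < 1, the series ∑_{n=0}^∞ C(2n,n)² · P_n((1 − 3k + 2k² − 2k³)/(4k² − 3k + 1)) · (−(1 + k)(4k² − 3k + 1)/(64k))^n · (C₃n³ + C₂n² + C₁n + C₀) converges to 8k^{3/2}(4k² − 3k + 1)/π, where C₃ = (4(k−1)²/(k+1))(2k−1)(4k² + 3k + 1)², C₂ = 12(k−1)(2k−1)(16k⁴ + k² − 1), C₁ = 288k⁶ − 400k⁵ + 102k⁴ + 97k³ − 93k² + 47k − 9, and C₀ = 2(32k⁶ − 44k⁵ + 9k⁴ + 16k³ − 14k² + 6k − 1). -/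

import Mathlib

open Real Filter

/-- The Legendre polynomial of degree `n`, given by the explicit formula
`P_n(x) = 2^{-n} ∑_{j=0}^{n} C(n,j)^2 (x-1)^{n-j} (x+1)^j`. -/
noncomputable def legendreP (n : ℕ) (x : ℝ) : ℝ :=
  (2 : ℝ)⁻¹ ^ n *
    ∑ j ∈ Finset.range (n + 1), (n.choose j : ℝ) ^ 2 * (x - 1) ^ (n - j) * (x + 1) ^ j

open Finset in
/-- Pascal's rule for binomially weighted sums. -/
lemma sum_range_choose_succ (n : ℕ) (φ : ℕ → ℝ) :
    ∑ w ∈ range (n + 2), φ w * ((n + 1).choose w : ℝ) =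
      ∑ w ∈ range (n + 1), φ w * (n.choose w : ℝ) +
        ∑ w ∈ range (n + 1), φ (w + 1) * (n.choose w : ℝ) := by
  rw [sum_range_succ' _ (n + 1)]
  simp only [Nat.choose_succ_succ', Nat.cast_add, mul_add, sum_add_distrib]
  have h := sum_range_succ' (fun w => φ w * (n.choose w : ℝ)) (n + 1)
  rw [sum_range_succ _ (n + 1)] at h
  simp at h ⊢
  linarith

open Finset in
/-- Vandermonde's convolution, tested against an arbitrary sequence. -/
lemma sum_sum_choose_mul_choose (p q : ℕ) (φ : ℕ → ℝ) :
    ∑ v ∈ range (p + 1), (∑ u ∈ range (q + 1), φ (v + u) * (q.choose u : ℝ)) * (p.choose v : ℝ) =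
      ∑ w ∈ range (p + q + 1), φ w * ((p + q).choose w : ℝ) := by
  induction p generalizing φ with
  | zero => simp
  | succ p ih =>
    rw [sum_range_choose_succ p (fun v => ∑ u ∈ range (q + 1), φ (v + u) * (q.choose u : ℝ)), ih]
    have h := ih (fun w => φ (w + 1))
    rw [show p + 1 + q + 1 = p + q + 2 by ring, show p + 1 + q = p + q + 1 by ring,
      sum_range_choose_succ (p + q) φ, ← h]
    simp only [add_right_comm]

/-- The coefficient `(1/2)_n / n!` of `(1 - x)^(-1/2)`. -/
noncomputable def halfBinom (n : ℕ) : ℝ := (n.centralBinom : ℝ) / 4 ^ n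

lemma halfBinom_zero : halfBinom 0 = 1 := by simp [halfBinom]

lemma halfBinom_pos (n : ℕ) : 0 < halfBinom n := by
  have := n.centralBinom_pos
  unfold halfBinom
  positivity

lemma succ_mul_halfBinom_succ (n : ℕ) :
    ((n : ℝ) + 1) * halfBinom (n + 1) = (n + 1 / 2) * halfBinom n := by
  have h := Nat.succ_mul_centralBinom_succ n
  have h' : ((n : ℝ) + 1) * ((n + 1).centralBinom : ℝ) = 2 * (2 * n + 1) * n.centralBinom := by
    exact_mod_cast h
  unfold halfBinom
  rw [pow_succ, ← mul_div_assoc, h']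
  field_simp
  ring

/-- The square of the Pochhammer symbol `(1/2)_n`. -/
noncomputable def halfPochSq (n : ℕ) : ℝ := ((n.factorial : ℝ) * halfBinom n) ^ 2

lemma halfPochSq_zero : halfPochSq 0 = 1 := by simp [halfPochSq, halfBinom_zero]

lemma halfPochSq_succ (n : ℕ) : halfPochSq (n + 1) = (n + 1 / 2) ^ 2 * halfPochSq n := by
  have h := succ_mul_halfBinom_succ n
  unfold halfPochSq
  rw [Nat.factorial_succ]
  push_cast
  rw [show ((n : ℝ) + 1) * n.factorial * halfBinom (n + 1)
    = n.factorial * (((n : ℝ) + 1) * halfBinom (n + 1)) by ring, h]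
  ring

/-- Summand of the terminating balanced hypergeometric sum. -/
noncomputable def saalTerm (p q w : ℕ) : ℝ :=
  (-1) ^ w * halfPochSq (p + q - w) * (w.factorial : ℝ) ^ 2 * p.choose w * q.choose w *
    (p + q).choose w

lemma cast_choose_succ_mul {n v : ℕ} (h : v ≤ n) :
    (n.choose (v + 1) : ℝ) = n.choose v * ((n : ℝ) - v) / (v + 1) := by
  have := Nat.choose_succ_right_eq n v
  rw [eq_div_iff (by positivity), ← Nat.cast_sub h]
  exact_mod_cast this

lemma cast_succ_choose_succ_mul (n v : ℕ) :
    ((n + 1).choose (v + 1) : ℝ) = n.choose v * ((n : ℝ) + 1) / (v + 1) := by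
  have := Nat.add_one_mul_choose_eq n v
  rw [eq_div_iff (by positivity), mul_comm (n.choose v : ℝ)]
  exact_mod_cast this.symm

lemma saalTerm_succ_sub (p q w : ℕ) (hw : w < p) :
    saalTerm p (q + 1) (w + 1) - (q + 1 / 2) ^ 2 * saalTerm p q (w + 1) =
      saalTerm p q (w + 1) * ((p : ℝ) - (w + 1)) * (p + 2 * q + 1 - (w + 1)) -
        saalTerm p q w * ((p : ℝ) - w) * (p + 2 * q + 1 - w) := by
  obtain ⟨e, rfl⟩ := Nat.exists_eq_add_of_lt hw
  unfold saalTerm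
  have e1 : w + e + 1 + (q + 1) - (w + 1) = (e + q) + 1 := by omega
  have e2 : w + e + 1 + q - (w + 1) = e + q := by omega
  have e3 : w + e + 1 + q - w = (e + q) + 1 := by omega
  rw [e1, e2, e3, halfPochSq_succ, ← add_assoc (w + e + 1) q 1,
    cast_succ_choose_succ_mul (w + e + 1 + q) w,
    cast_succ_choose_succ_mul q w, cast_choose_succ_mul (n := w + e + 1) (v := w) (by omega),
    cast_choose_succ_mul (n := w + e + 1 + q) (v := w) (by omega), Nat.factorial_succ]
  rcases le_or_gt w q with h | h
  · rw [cast_choose_succ_mul (n := q) (v := w) h]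
    push_cast
    field_simp
    ring
  · rw [Nat.choose_eq_zero_of_lt h, Nat.choose_eq_zero_of_lt (h.trans (Nat.lt_succ_self w))]
    simp

open Finset in
/-- The Pfaff–Saalschütz evaluation needed for the product formula. -/
lemma sum_saalTerm (p q : ℕ) :
    ∑ w ∈ range (p + 1), saalTerm p q w = halfPochSq p * halfPochSq q := by
  induction q with
  | zero =>
    rw [sum_range_succ', sum_eq_zero]
    · simp [saalTerm, halfPochSq_zero]
    · intro w _
      simp [saalTerm]
  | succ q ih =>
    have key : ∀ m ≤ p, ∑ w ∈ range (m + 1),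
        (saalTerm p (q + 1) w - (q + 1 / 2) ^ 2 * saalTerm p q w) =
          saalTerm p q m * ((p : ℝ) - m) * (p + 2 * q + 1 - m) := by
      intro m
      induction m with
      | zero =>
        intro _
        simp only [zero_add, range_one, sum_singleton, saalTerm, Nat.sub_zero, ← add_assoc,
          halfPochSq_succ, Nat.choose_zero_right]
        push_cast
        simp only [Nat.factorial_zero]
        push_cast
        ring
      | succ m ihm =>
        intro hm
        rw [sum_range_succ, ihm (by omega), saalTerm_succ_sub p q m (by omega)]
        push_cast
        ring
    have h := key p le_rfl
    rw [sum_sub_distrib, ← mul_sum, ih] at h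
    rw [halfPochSq_succ]
    simp at h ⊢
    linarith

open Finset in
/-- Coefficient identity behind Bailey's factorisation of the Appell function `F₄`. -/
lemma sum_antidiagonal_bailey (p q : ℕ) :
    ∑ x ∈ antidiagonal p, ∑ y ∈ antidiagonal q,
      halfBinom (x.1 + y.1) ^ 2 * ((x.1 + y.1).choose x.1 : ℝ) ^ 2 *
        (x.1.choose y.2 * (-1) ^ y.2) * (y.1.choose x.2 * (-1) ^ x.2) =
      halfBinom p ^ 2 * halfBinom q ^ 2 := by
  set φ : ℕ → ℝ := fun w => (-1) ^ w * halfPochSq (p + q - w) * (w.factorial : ℝ) ^ 2 *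
    p.choose w * q.choose w / ((p.factorial : ℝ) * q.factorial) ^ 2 with hφ
  have hterm : ∀ x ∈ antidiagonal p, ∀ y ∈ antidiagonal q,
      halfBinom (x.1 + y.1) ^ 2 * ((x.1 + y.1).choose x.1 : ℝ) ^ 2 *
        (x.1.choose y.2 * (-1) ^ y.2) * (y.1.choose x.2 * (-1) ^ x.2) =
      φ (x.2 + y.2) * (q.choose y.2 : ℝ) * (p.choose x.2 : ℝ) := by
    rintro ⟨i, v⟩ hx ⟨j, u⟩ hy
    rw [HasAntidiagonal.mem_antidiagonal] at hx hy
    simp only at hx hy ⊢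
    subst hx hy
    simp only [hφ]
    by_cases h : u ≤ i ∧ v ≤ j
    · obtain ⟨⟨a, rfl⟩, ⟨b, rfl⟩⟩ := And.imp Nat.exists_eq_add_of_le Nat.exists_eq_add_of_le h
      have e1 : u + a + v + (v + b + u) - (v + u) = u + a + (v + b) := by omega
      rw [e1]
      have c1 : ((u + a + (v + b)).choose (u + a) : ℝ) =
          (u + a + (v + b)).factorial / ((u + a).factorial * (v + b).factorial) :=
        Nat.cast_add_choose ℝ
      have c2 : ((u + a).choose u : ℝ) = (u + a).factorial / (u.factorial * a.factorial) :=
        Nat.cast_add_choose ℝ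
      have c3 : ((v + b).choose v : ℝ) = (v + b).factorial / (v.factorial * b.factorial) :=
        Nat.cast_add_choose ℝ
      have c4 : ((u + a + v).choose (v + u) : ℝ) =
          (u + a + v).factorial / ((v + u).factorial * a.factorial) := by
        rw [show u + a + v = v + u + a by ring]
        exact Nat.cast_add_choose ℝ
      have c5 : ((v + b + u).choose (v + u) : ℝ) =
          (v + b + u).factorial / ((v + u).factorial * b.factorial) := by
        rw [show v + b + u = v + u + b by ring]
        exact Nat.cast_add_choose ℝ
      have c6 : ((v + b + u).choose u : ℝ) =
          (v + b + u).factorial / (u.factorial * (v + b).factorial) := by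
        rw [show v + b + u = u + (v + b) by ring]
        exact Nat.cast_add_choose ℝ
      have c7 : ((u + a + v).choose v : ℝ) =
          (u + a + v).factorial / (v.factorial * (u + a).factorial) := by
        rw [show u + a + v = v + (u + a) by ring]
        exact Nat.cast_add_choose ℝ
      rw [c1, c2, c3, c4, c5, c6, c7, halfPochSq]
      field_simp
      ring
    · have hz : (i.choose u : ℝ) * j.choose v = 0 := by
        rw [not_and_or, not_le, not_le] at h
        rcases h with h | h <;> simp [Nat.choose_eq_zero_of_lt h]
      have hz' : ((i + v).choose (v + u) : ℝ) * (j + u).choose (v + u) = 0 := by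
        rw [not_and_or, not_le, not_le] at h
        rcases h with h | h
        · rw [Nat.choose_eq_zero_of_lt (show i + v < v + u by omega)]; simp
        · rw [Nat.choose_eq_zero_of_lt (show j + u < v + u by omega)]; simp
      linear_combination (halfBinom (i + j) ^ 2 * ((i + j).choose i : ℝ) ^ 2 * (-1) ^ u *
        (-1) ^ v) * hz - ((-1) ^ (v + u) * halfPochSq (i + v + (j + u) - (v + u)) *
        ((v + u).factorial : ℝ) ^ 2 / (((i + v).factorial : ℝ) * (j + u).factorial) ^ 2 *
        ((j + u).choose u : ℝ) * ((i + v).choose v : ℝ)) * hz'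
  rw [sum_congr rfl fun x hx => sum_congr rfl (hterm x hx)]
  simp only [← sum_mul]
  rw [Nat.sum_antidiagonal_eq_sum_range_succ_mk]
  rw [← sum_range_reflect]
  have hin : ∀ v, ∑ y ∈ antidiagonal q, φ (v + y.2) * (q.choose y.2 : ℝ) =
      ∑ u ∈ range (q + 1), φ (v + u) * (q.choose u : ℝ) := by
    intro v
    rw [Nat.sum_antidiagonal_eq_sum_range_succ_mk, ← sum_range_reflect]
    refine sum_congr rfl fun u hu => ?_
    have : q - (q + 1 - 1 - u) = u := by have := mem_range.1 hu; omega
    rw [this]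
  have hout : ∀ v ∈ range (p + 1), (∑ y ∈ antidiagonal q,
      φ ((p + 1 - 1 - v, p - (p + 1 - 1 - v)).2 + y.2) * (q.choose y.2 : ℝ)) *
        (p.choose (p + 1 - 1 - v, p - (p + 1 - 1 - v)).2 : ℝ) =
      (∑ u ∈ range (q + 1), φ (v + u) * (q.choose u : ℝ)) * (p.choose v : ℝ) := by
    intro v hv
    have : p - (p + 1 - 1 - v) = v := by have := mem_range.1 hv; omega
    simp only [this, hin]
  rw [sum_congr rfl hout, sum_sum_choose_mul_choose]
  have hsplit : ∑ w ∈ range (p + q + 1), φ w * ((p + q).choose w : ℝ) =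
      ∑ w ∈ range (p + 1), φ w * ((p + q).choose w : ℝ) := by
    refine (sum_subset (range_subset_range.2 (by omega)) fun w _ hw => ?_).symm
    have : p < w := by simpa using hw
    simp [hφ, Nat.choose_eq_zero_of_lt this]
  have hconv : ∀ w ∈ range (p + 1), φ w * ((p + q).choose w : ℝ) =
      saalTerm p q w / ((p.factorial : ℝ) * q.factorial) ^ 2 := by
    intro w _
    simp only [hφ, saalTerm]
    ring
  rw [hsplit, sum_congr rfl hconv, ← sum_div, sum_saalTerm, halfPochSq, halfPochSq]
  field_simp

/-- The coefficient sequence `c` defines a power series converging on the open unit disc. -/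
def UnitDiscSummable (c : ℕ → ℝ) : Prop :=
  ∀ r : ℝ, 0 ≤ r → r < 1 → Summable fun n => |c n| * r ^ n

/-- The sum of the power series with coefficients `c`. -/
noncomputable def powerSum (c : ℕ → ℝ) (u : ℝ) : ℝ := ∑' n, c n * u ^ n

lemma unitDiscSummable_of_abs_le {c : ℕ → ℝ} {K : ℝ} (h : ∀ n, |c n| ≤ K) :
    UnitDiscSummable c := fun r hr0 hr1 =>
  Summable.of_nonneg_of_le (fun n => by positivity)
    (fun n => mul_le_mul_of_nonneg_right (h n) (by positivity))
    ((summable_geometric_of_lt_one hr0 hr1).mul_left K)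

namespace UnitDiscSummable

variable {c : ℕ → ℝ}

lemma natCast_mul (h : UnitDiscSummable c) : UnitDiscSummable fun n => n * c n := by
  intro r hr0 hr1
  obtain ⟨s, hrs, hs1⟩ := exists_between hr1
  have hs0 : 0 < s := hr0.trans_lt hrs
  have hlim := tendsto_self_mul_const_pow_of_lt_one (r := r / s) (by positivity)
    ((div_lt_one hs0).2 hrs)
  refine Summable.of_norm_bounded_eventually_nat (h s hs0.le hs1) ?_
  filter_upwards [hlim.eventually (eventually_le_nhds (zero_lt_one' ℝ))] with n hn
  rw [div_pow, ← mul_div_assoc, div_le_one (by positivity)] at hn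
  rw [Real.norm_eq_abs, abs_mul, abs_abs, abs_mul, Nat.abs_cast,
    abs_of_nonneg (pow_nonneg hr0 n)]
  calc (n : ℝ) * |c n| * r ^ n = |c n| * (n * r ^ n) := by ring
    _ ≤ _ := mul_le_mul_of_nonneg_left hn (abs_nonneg _)

lemma summable (h : UnitDiscSummable c) {u : ℝ} (hu : |u| < 1) :
    Summable fun n => c n * u ^ n :=
  Summable.of_norm (by simpa [abs_mul, abs_pow] using h |u| (abs_nonneg u) hu)

lemma analyticAt (h : UnitDiscSummable c) {u : ℝ} (hu : |u| < 1) :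
    AnalyticAt ℝ (powerSum c) u := by
  set p := FormalMultilinearSeries.ofScalars ℝ c with hp
  obtain ⟨r, hur, hr1⟩ := exists_between hu
  have hr0 : 0 < r := (abs_nonneg u).trans_lt hur
  lift r to NNReal using hr0.le
  have hrad : (r : ENNReal) ≤ p.radius := by
    refine p.le_radius_of_summable ?_
    simpa [hp, FormalMultilinearSeries.ofScalars_norm] using h r r.2 hr1
  have hpos : 0 < p.radius := lt_of_lt_of_le (by exact_mod_cast hr0) hrad
  have hball := p.hasFPowerSeriesOnBall hpos
  have hsum : p.sum = powerSum c := by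
    ext v
    exact FormalMultilinearSeries.ofScalars_sum_eq c v
  rw [hsum] at hball
  refine hball.analyticAt_of_mem ?_
  refine lt_of_lt_of_le ?_ hrad
  rw [edist_zero_right, ← ofReal_norm, ENNReal.ofReal_lt_coe_iff (by positivity)]
  simpa using hur

lemma hasDerivAt (h : UnitDiscSummable c) {u : ℝ} (hu : |u| < 1) :
    HasDerivAt (powerSum c) (∑' n, c n * (n * u ^ (n - 1))) u := by
  obtain ⟨r, hur, hr1⟩ := exists_between hu
  have hr0 : 0 < r := (abs_nonneg u).trans_lt hur
  have hb : Summable fun n => |c n| * (n * r ^ (n - 1)) := by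
    refine ((h.natCast_mul r hr0.le hr1).mul_left r⁻¹).congr fun n => ?_
    rcases n with _ | n
    · simp
    · rw [abs_mul, Nat.abs_cast, Nat.add_sub_cancel, pow_succ]
      field_simp
  refine hasDerivAt_tsum_of_isPreconnected (t := Set.Ioo (-r) r) (y₀ := 0) hb isOpen_Ioo
    isPreconnected_Ioo (fun n y _ => (hasDerivAt_pow n y).const_mul (c n)) ?_
    ⟨by linarith, hr0⟩ ?_ (abs_lt.1 hur)
  · intro n y hy
    rw [Real.norm_eq_abs, abs_mul, abs_mul, Nat.abs_cast, abs_pow]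
    gcongr
    exact (abs_lt.2 hy).le
  · exact h.summable (by simp)

lemma hasDerivAt_succ (h : UnitDiscSummable c) {u : ℝ} (hu : |u| < 1) :
    HasDerivAt (powerSum c) (powerSum (fun n => (n + 1) * c (n + 1)) u) u := by
  convert! h.hasDerivAt hu using 1
  have hs : Summable fun n => c n * (n * u ^ (n - 1)) := by
    refine (summable_nat_add_iff 1).1 ?_
    by_cases h0 : u = 0
    · subst h0
      refine summable_of_ne_finset_zero (s := {0}) fun n hn => ?_
      simp at hn
      simp [hn]
    · refine (((summable_nat_add_iff 1).2 (h.natCast_mul.summable hu)).mul_left u⁻¹).congr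
        fun n => ?_
      rw [Nat.add_sub_cancel, pow_succ]
      field_simp
  rw [hs.tsum_eq_zero_add, powerSum]
  simp only [Nat.cast_zero, zero_mul, mul_zero, zero_add, Nat.add_sub_cancel, Nat.cast_add,
    Nat.cast_one]
  exact tsum_congr fun n => by ring

lemma exists_hasDerivAt (h : UnitDiscSummable c) {u : ℝ} (hu : |u| < 1) :
    ∃ d, HasDerivAt (powerSum c) d u ∧ u * d = powerSum (fun n => n * c n) u := by
  refine ⟨_, h.hasDerivAt hu, ?_⟩
  rw [powerSum, ← tsum_mul_left]
  refine tsum_congr fun n => ?_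
  rcases n with _ | n
  · simp
  · rw [Nat.add_sub_cancel, pow_succ]
    ring

end UnitDiscSummable

/-- The backward difference of a sequence, with `0` before the first term. -/
def backDiff (c : ℕ → ℝ) : ℕ → ℝ
  | 0 => c 0
  | n + 1 => c (n + 1) - c n

lemma sum_range_succ_backDiff (c : ℕ → ℝ) (n : ℕ) :
    ∑ i ∈ Finset.range (n + 1), backDiff c i = c n := by
  induction n with
  | zero => simp [backDiff]
  | succ n ih => rw [Finset.sum_range_succ, ih, backDiff]; ring

lemma one_sub_mul_powerSum {c : ℕ → ℝ} (h : UnitDiscSummable c) {u : ℝ} (hu : |u| < 1) :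
    (1 - u) * powerSum c u = powerSum (backDiff c) u := by
  have hs := h.summable hu
  have hs1 := (summable_nat_add_iff 1).2 hs
  have hd : Summable fun n => backDiff c n * u ^ n := by
    refine (summable_nat_add_iff 1).1 ((hs1.sub (hs.mul_left u)).congr fun n => ?_)
    rw [backDiff, pow_succ]
    ring
  have e : ∀ n, backDiff c (n + 1) * u ^ (n + 1) =
      c (n + 1) * u ^ (n + 1) - u * (c n * u ^ n) := by
    intro n
    rw [backDiff, pow_succ]
    ring
  unfold powerSum
  rw [hd.tsum_eq_zero_add, tsum_congr e, hs1.tsum_sub (hs.mul_left u), tsum_mul_left, sub_mul,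
    one_mul]
  nth_rw 1 [hs.tsum_eq_zero_add]
  simp only [backDiff]
  ring

open Topology in
/-- Abel's theorem for the Abel mean `(1 - u) ∑ cₙ uⁿ`. -/
lemma tendsto_one_sub_mul_powerSum {c : ℕ → ℝ} {L : ℝ} (h : Tendsto c atTop (𝓝 L)) :
    UnitDiscSummable c ∧ Tendsto (fun u => (1 - u) * powerSum c u) (𝓝[<] 1) (𝓝 L) := by
  obtain ⟨K, hK⟩ := (Metric.isBounded_range_of_tendsto c h).exists_norm_le
  have hc : UnitDiscSummable c :=
    unitDiscSummable_of_abs_le (K := K) fun n => hK _ (Set.mem_range_self n)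
  refine ⟨hc, ?_⟩
  have hsum : Tendsto (fun n => ∑ i ∈ Finset.range n, backDiff c i) atTop (𝓝 L) := by
    rw [← tendsto_add_atTop_iff_nat 1]
    simpa only [sum_range_succ_backDiff] using h
  refine (Real.tendsto_tsum_powerSeries_nhdsWithin_lt hsum).congr' ?_
  have : Set.Ioo (0 : ℝ) 1 ∈ 𝓝[<] (1 : ℝ) := Ioo_mem_nhdsLT zero_lt_one
  filter_upwards [this] with u hu
  exact (one_sub_mul_powerSum hc (abs_lt.2 ⟨by linarith [hu.1], hu.2⟩)).symm

/-- Coefficients of the hypergeometric function `₂F₁(1/2, 1/2; 1; ·)`. -/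
noncomputable def ellCoeff (n : ℕ) : ℝ := halfBinom n ^ 2

lemma ellCoeff_nonneg (n : ℕ) : 0 ≤ ellCoeff n := sq_nonneg _

lemma succ_sq_mul_ellCoeff_succ (n : ℕ) :
    ((n : ℝ) + 1) ^ 2 * ellCoeff (n + 1) = (n + 1 / 2) ^ 2 * ellCoeff n := by
  rw [ellCoeff, ellCoeff, ← mul_pow, ← mul_pow, succ_mul_halfBinom_succ]

lemma ellCoeff_eq_inv_wallis (n : ℕ) :
    ellCoeff n * (2 * n + 1) = (Real.Wallis.W n)⁻¹ := by
  induction n with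
  | zero => simp [ellCoeff, halfBinom_zero, Real.Wallis.W]
  | succ n ih =>
    have h := succ_sq_mul_ellCoeff_succ n
    have h' : ellCoeff (n + 1) = (n + 1 / 2) ^ 2 * ellCoeff n / ((n : ℝ) + 1) ^ 2 := by
      rw [eq_div_iff (by positivity), ← h]
      ring
    rw [Real.Wallis.W_succ, mul_inv, ← ih, h']
    push_cast
    field_simp
    ring

open Topology in
lemma tendsto_natCast_mul_ellCoeff :
    Tendsto (fun n : ℕ => (n : ℝ) * ellCoeff n) atTop (𝓝 (1 / π)) := by
  have h1 := Real.Wallis.tendsto_W_nhds_pi_div_two.inv₀ (by positivity)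
  have h2 : Tendsto (fun n : ℕ => (n : ℝ) / (2 * n + 1)) atTop (𝓝 (1 / 2)) := by
    have := (tendsto_const_nhds (x := (2 : ℝ))).add
      (tendsto_one_div_atTop_nhds_zero_nat (𝕜 := ℝ))
    have := this.inv₀ (by norm_num)
    refine (this.congr' ?_).trans (by norm_num)
    filter_upwards [eventually_gt_atTop 0] with n hn
    field_simp
  have h3 := h1.mul h2
  refine (h3.congr fun n => ?_).trans (by
    rw [show (π / 2)⁻¹ * (1 / 2) = 1 / π by field_simp])
  rw [← ellCoeff_eq_inv_wallis]
  field_simp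

open Topology in
lemma tendsto_ellCoeff : Tendsto ellCoeff atTop (𝓝 0) := by
  have := tendsto_natCast_mul_ellCoeff.mul (tendsto_one_div_atTop_nhds_zero_nat (𝕜 := ℝ))
  rw [mul_zero] at this
  refine this.congr' ?_
  filter_upwards [eventually_gt_atTop 0] with n hn
  field_simp

/-- The function `₂F₁(1/2, 1/2; 1; u)`, that is `2 K(√u) / π`. -/
noncomputable def ellF : ℝ → ℝ := powerSum ellCoeff

/-- The derivative of `ellF`. -/
noncomputable def ellF' : ℝ → ℝ := powerSum fun n => (n + 1) * ellCoeff (n + 1)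

/-- The function `ellQ` is `1 - u` times the derivative of `ellF`. -/
noncomputable def ellQ : ℝ → ℝ := powerSum fun n => ellCoeff n / (4 * (n + 1))

lemma unitDiscSummable_ellCoeff : UnitDiscSummable ellCoeff :=
  (tendsto_one_sub_mul_powerSum tendsto_ellCoeff).1

lemma hasDerivAt_ellF {u : ℝ} (hu : |u| < 1) : HasDerivAt ellF (ellF' u) u :=
  unitDiscSummable_ellCoeff.hasDerivAt_succ hu

lemma unitDiscSummable_ellCoeff_div :
    UnitDiscSummable fun n => ellCoeff n / (4 * (n + 1)) := by
  intro r hr0 hr1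
  refine Summable.of_nonneg_of_le (fun n => mul_nonneg (abs_nonneg _) (pow_nonneg hr0 n))
    (fun n => ?_) (unitDiscSummable_ellCoeff r hr0 hr1)
  refine mul_le_mul_of_nonneg_right ?_ (pow_nonneg hr0 n)
  rw [abs_div]
  refine div_le_self (abs_nonneg _) ?_
  rw [abs_of_pos (by positivity)]
  have : (0 : ℝ) ≤ n := n.cast_nonneg
  linarith

/-- The function `ellP` is `u * (1 - u)` times the derivative of `ellF`. -/
noncomputable def ellP (u : ℝ) : ℝ := u * ellQ u

lemma one_sub_mul_ellF' {u : ℝ} (hu : |u| < 1) : (1 - u) * ellF' u = ellQ u := by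
  have hc : UnitDiscSummable fun n : ℕ => ((n : ℝ) + 1) * ellCoeff (n + 1) := by
    have h : Tendsto (fun n : ℕ => ((n : ℝ) + 1) * ellCoeff (n + 1)) atTop (nhds (1 / π)) := by
      simpa using (tendsto_add_atTop_iff_nat 1).2 tendsto_natCast_mul_ellCoeff
    exact (tendsto_one_sub_mul_powerSum h).1
  rw [ellF', one_sub_mul_powerSum hc hu, ellQ]
  congr 1
  ext n
  have h := succ_sq_mul_ellCoeff_succ n
  rcases n with _ | n
  · simp [backDiff] at h ⊢
    linarith
  · rw [backDiff, eq_div_iff (by positivity)]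
    push_cast at h ⊢
    linear_combination 4 * h

lemma mul_one_sub_mul_ellF' {u : ℝ} (hu : |u| < 1) : u * (1 - u) * ellF' u = ellP u := by
  rw [mul_assoc, one_sub_mul_ellF' hu, ellP]

lemma hasDerivAt_ellP {u : ℝ} (hu : |u| < 1) : HasDerivAt ellP (ellF u / 4) u := by
  obtain ⟨d, hd, hud⟩ := unitDiscSummable_ellCoeff_div.exists_hasDerivAt hu
  have h := (hasDerivAt_id u).mul hd
  refine h.congr_deriv ?_
  have h1 := unitDiscSummable_ellCoeff_div.summable hu
  have h2 := unitDiscSummable_ellCoeff_div.natCast_mul.summable hu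
  rw [id, one_mul, hud, ellF, powerSum, powerSum, powerSum, ← h1.tsum_add h2, ← tsum_div_const]
  refine tsum_congr fun n => ?_
  field_simp
  ring

lemma analyticAt_ellF {u : ℝ} (hu : |u| < 1) : AnalyticAt ℝ ellF u :=
  unitDiscSummable_ellCoeff.analyticAt hu

lemma continuousAt_ellQ {u : ℝ} (hu : |u| < 1) : ContinuousAt ellQ u :=
  (unitDiscSummable_ellCoeff_div.analyticAt hu).continuousAt

open Topology in
lemma tendsto_one_sub_mul_ellF : Tendsto (fun u => (1 - u) * ellF u) (𝓝[<] 1) (𝓝 0) :=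
  (tendsto_one_sub_mul_powerSum tendsto_ellCoeff).2

open Topology in
lemma tendsto_ellP : Tendsto ellP (𝓝[<] 1) (𝓝 (1 / π)) := by
  refine (tendsto_one_sub_mul_powerSum tendsto_natCast_mul_ellCoeff).2.congr' ?_
  have : Set.Ioo (0 : ℝ) 1 ∈ 𝓝[<] (1 : ℝ) := Ioo_mem_nhdsLT zero_lt_one
  filter_upwards [this] with u hu
  have hu' : |u| < 1 := abs_lt.2 ⟨by linarith [hu.1], hu.2⟩
  obtain ⟨d, hd, hud⟩ := unitDiscSummable_ellCoeff.exists_hasDerivAt hu'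
  rw [← hud, ← mul_one_sub_mul_ellF' hu', (hasDerivAt_ellF hu').unique hd]
  ring

open Polynomial in
/-- A coefficient of a polynomial is bounded by the supremum of the polynomial on the unit
circle. -/
lemma norm_coeff_le_of_forall_norm_eval_le (p : ℂ[X]) {K : ℝ}
    (h : ∀ z : ℂ, ‖z‖ = 1 → ‖p.eval z‖ ≤ K) (n : ℕ) : ‖p.coeff n‖ ≤ K := by
  have hK : 0 ≤ K := (norm_nonneg _).trans (h 1 norm_one)
  by_cases hn : n ∈ p.support
  · have h1 : ‖p.coeff n‖ ^ 2 ≤ ∑ i ∈ p.support, ‖p.coeff i‖ ^ 2 :=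
      Finset.single_le_sum (f := fun i => ‖p.coeff i‖ ^ 2) (fun i _ => sq_nonneg _) hn
    rw [p.sum_sq_norm_coeff_eq_circleAverage] at h1
    have h2 : Real.circleAverage (fun z => ‖p.eval z‖ ^ 2) 0 1 ≤ K ^ 2 := by
      refine Real.circleAverage_mono_on_of_le_circle ?_ fun z hz => ?_
      · refine ContinuousOn.circleIntegrable' (Continuous.continuousOn ?_)
        fun_prop
      · have hz' : ‖z‖ = 1 := by simpa using hz
        have := h z hz'
        gcongr
    exact (pow_le_pow_iff_left₀ (norm_nonneg _) hK two_ne_zero).1 (h1.trans h2)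
  · rw [notMem_support_iff.1 hn, norm_zero]
    exact hK

lemma legendreP_eq_sum (n : ℕ) (x : ℝ) : legendreP n x =
    ∑ j ∈ Finset.range (n + 1),
      (n.choose j : ℝ) ^ 2 * ((x - 1) / 2) ^ (n - j) * ((x + 1) / 2) ^ j := by
  rw [legendreP, Finset.mul_sum]
  refine Finset.sum_congr rfl fun j hj => ?_
  have hj' : n - j + j = n := Nat.sub_add_cancel (Nat.lt_succ_iff.1 (Finset.mem_range.1 hj))
  rw [div_pow, div_pow]
  nth_rw 1 [← hj']
  rw [pow_add, inv_pow, inv_pow]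
  ring

open Polynomial in
lemma abs_legendreP_le_one (n : ℕ) {x : ℝ} (hx : |x| < 1) : |legendreP n x| ≤ 1 := by
  have hx2 : 0 < 1 - x ^ 2 := by
    have := (sq_lt_one_iff_abs_lt_one x).2 hx
    linarith
  set τ : ℝ := 2 / √(1 - x ^ 2) with hτ
  have hτ0 : 0 < τ := by positivity
  have hτ2 : τ ^ 2 * (1 - x ^ 2) = 4 := by
    rw [hτ, div_pow, Real.sq_sqrt hx2.le]
    field_simp
    norm_num
  set a : ℂ := ((τ * ((x - 1) / 2) : ℝ) : ℂ) with ha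
  set b : ℂ := ((τ * ((x + 1) / 2) : ℝ) : ℂ) with hb
  set p : ℂ[X] := ((1 + X) ^ n : ℂ[X]).comp (C b * X) * ((1 + X) ^ n : ℂ[X]).comp (C a * X)
    with hp
  have hcoeff : p.coeff n = ((τ ^ n * legendreP n x : ℝ) : ℂ) := by
    rw [hp, coeff_mul, Finset.Nat.sum_antidiagonal_eq_sum_range_succ_mk, legendreP_eq_sum,
      Finset.mul_sum, Complex.ofReal_sum]
    refine Finset.sum_congr rfl fun j hj => ?_
    have hj' : j ≤ n := Nat.lt_succ_iff.1 (Finset.mem_range.1 hj)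
    simp only [comp_C_mul_X_coeff, coeff_one_add_X_pow, Nat.choose_symm hj', ha, hb]
    have hpow : τ ^ n = τ ^ (n - j) * τ ^ j := by rw [← pow_add, Nat.sub_add_cancel hj']
    rw [hpow]
    push_cast
    rw [mul_pow, mul_pow]
    ring
  have heval : ∀ z : ℂ, ‖z‖ = 1 → ‖p.eval z‖ ≤ τ ^ n := by
    intro z hz
    have h1 : p.eval z = ((1 + b * z) * (1 + a * z)) ^ n := by
      simp [hp, mul_pow]
    rw [h1, norm_pow]
    refine pow_le_pow_left₀ (norm_nonneg _) ?_ n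
    refine (pow_le_pow_iff_left₀ (norm_nonneg _) hτ0.le two_ne_zero).1 ?_
    have hz2 : z.re * z.re + z.im * z.im = 1 := by
      rw [← Complex.normSq_apply, Complex.normSq_eq_norm_sq, hz, one_pow]
    have hab : b * a = -1 := by
      rw [ha, hb, ← Complex.ofReal_mul]
      have : τ * ((x + 1) / 2) * (τ * ((x - 1) / 2)) = -1 := by linear_combination -hτ2 / 4
      rw [this]
      simp
    have hs : b + a = ((τ * x : ℝ) : ℂ) := by
      rw [ha, hb, ← Complex.ofReal_add]
      congr 1
      ring
    have h2 : (1 + b * z) * (1 + a * z) = 1 + ((τ * x : ℝ) : ℂ) * z - z * z := by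
      linear_combination z * hs + z ^ 2 * hab
    have key : ‖1 + ((τ * x : ℝ) : ℂ) * z - z * z‖ ^ 2 = (τ * x) ^ 2 + 4 * (z.im * z.im) := by
      generalize τ * x = t
      rw [← Complex.normSq_eq_norm_sq, Complex.normSq_apply]
      simp only [Complex.sub_re, Complex.add_re, Complex.one_re, Complex.mul_re,
        Complex.sub_im, Complex.add_im, Complex.one_im, Complex.mul_im, Complex.ofReal_re,
        Complex.ofReal_im]
      linear_combination (t ^ 2 - 2 * t * z.re - 1 + z.re ^ 2 + z.im ^ 2) * hz2
    rw [h2, key]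
    nlinarith [mul_self_nonneg z.re]
  have h := norm_coeff_le_of_forall_norm_eval_le p heval n
  rw [hcoeff, Complex.norm_real, Real.norm_eq_abs, abs_mul, abs_of_pos (by positivity)] at h
  have hτn : 0 < τ ^ n := by positivity
  exact le_of_mul_le_mul_left (by simpa using h) hτn

lemma abs_sq_lt_one {k : ℝ} (hk0 : 7 / 40 < k) (hk1 : k < 1) : |k ^ 2| < 1 := by
  rw [abs_lt]
  constructor <;> nlinarith

lemma abs_landen_lt_one {k : ℝ} (hk0 : 7 / 40 < k) (hk1 : k < 1) :
    |-(1 - k) ^ 2 / (4 * k)| < 1 := by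
  have hk : 0 < k := by linarith
  rw [abs_div, abs_neg, abs_of_nonneg (sq_nonneg _), abs_of_pos (by positivity),
    div_lt_one (by positivity)]
  nlinarith [mul_pos (sub_pos.2 hk0) (sub_pos.2 hk1)]

/-- The bilinear combination of `₂F₁` values occurring in Legendre's relation. -/
noncomputable def legendreForm (k : ℝ) : ℝ :=
  2 * ellP (k ^ 2) * ellF (-(1 - k) ^ 2 / (4 * k)) +
    (1 - k ^ 2) / 2 * ellF (k ^ 2) * ellF (-(1 - k) ^ 2 / (4 * k)) +
    4 * k * ellF (k ^ 2) * ellP (-(1 - k) ^ 2 / (4 * k))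

lemma hasDerivAt_legendreForm {k : ℝ} (hk0 : 7 / 40 < k) (hk1 : k < 1) :
    HasDerivAt legendreForm (legendreForm k / (2 * k)) k := by
  have hk : 0 < k := by linarith
  have ha := abs_sq_lt_one hk0 hk1
  have hb := abs_landen_lt_one hk0 hk1
  have h1k : 1 - k ≠ 0 := by linarith
  have h1k' : 1 + k ≠ 0 := by linarith
  have h1k2 : 1 - k ^ 2 ≠ 0 := by
    rw [show 1 - k ^ 2 = (1 - k) * (1 + k) by ring]
    exact mul_ne_zero h1k h1k'
  have da : HasDerivAt (fun k : ℝ => k ^ 2) (2 * k) k := by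
    simpa using hasDerivAt_pow 2 k
  have db : HasDerivAt (fun k : ℝ => -(1 - k) ^ 2 / (4 * k)) ((1 - k ^ 2) / (4 * k ^ 2)) k := by
    have h := ((((hasDerivAt_id k).const_sub 1).pow 2).neg).div ((hasDerivAt_id k).const_mul 4)
      (by simpa using hk.ne')
    refine h.congr_deriv ?_
    simp
    field_simp
    ring
  have Fa : HasDerivAt (fun k : ℝ => ellF (k ^ 2))
      (ellF' (k ^ 2) * (2 * k)) k :=
    HasDerivAt.comp (h₂ := ellF) (h := fun k : ℝ => k ^ 2) k (hasDerivAt_ellF ha) da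
  have Pa : HasDerivAt (fun k : ℝ => ellP (k ^ 2))
      (ellF (k ^ 2) / 4 * (2 * k)) k :=
    HasDerivAt.comp (h₂ := ellP) (h := fun k : ℝ => k ^ 2) k (hasDerivAt_ellP ha) da
  have Fb : HasDerivAt (fun k : ℝ => ellF (-(1 - k) ^ 2 / (4 * k)))
      (ellF' (-(1 - k) ^ 2 / (4 * k)) * ((1 - k ^ 2) / (4 * k ^ 2))) k :=
    HasDerivAt.comp (h₂ := ellF) (h := fun k : ℝ => -(1 - k) ^ 2 / (4 * k)) k
      (hasDerivAt_ellF hb) db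
  have Pb : HasDerivAt (fun k : ℝ => ellP (-(1 - k) ^ 2 / (4 * k)))
      (ellF (-(1 - k) ^ 2 / (4 * k)) / 4 * ((1 - k ^ 2) / (4 * k ^ 2))) k :=
    HasDerivAt.comp (h₂ := ellP) (h := fun k : ℝ => -(1 - k) ^ 2 / (4 * k)) k
      (hasDerivAt_ellP hb) db
  have ea := mul_one_sub_mul_ellF' ha
  have eb := mul_one_sub_mul_ellF' hb
  have ea' : ellF' (k ^ 2) = ellP (k ^ 2) / (k ^ 2 * (1 - k ^ 2)) := by
    rw [eq_div_iff (by positivity), ← ea]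
    ring
  have eb' : ellF' (-(1 - k) ^ 2 / (4 * k)) * ((1 - k ^ 2) / (4 * k ^ 2)) =
      -4 * ellP (-(1 - k) ^ 2 / (4 * k)) / (1 - k ^ 2) := by
    rw [← eb, eq_div_iff h1k2]
    field_simp
    ring
  rw [ea'] at Fa
  rw [eb'] at Fb
  have hd1 : HasDerivAt (fun k : ℝ => (1 - k ^ 2) / 2) (-(2 * k) / 2) k :=
    (da.const_sub 1).div_const 2
  have hd2 : HasDerivAt (fun k : ℝ => 4 * k) 4 k := by
    simpa using (hasDerivAt_id k).const_mul 4
  have h := (((Pa.const_mul 2).mul Fb).add ((hd1.mul Fa).mul Fb)).add ((hd2.mul Fa).mul Pb)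
  refine h.congr_deriv ?_
  simp only [Pi.mul_apply, legendreForm]
  generalize ellF (-(1 - k) ^ 2 / (4 * k)) = F₂
  generalize ellP (-(1 - k) ^ 2 / (4 * k)) = P₂
  generalize ellF (k ^ 2) = F₁
  generalize ellP (k ^ 2) = P₁
  field_simp
  ring

open Topology in
lemma tendsto_legendreForm : Tendsto legendreForm (𝓝[<] 1) (𝓝 (2 / π)) := by
  have ha : Tendsto (fun k : ℝ => k ^ 2) (𝓝[<] 1) (𝓝[<] 1) := by
    refine tendsto_nhdsWithin_iff.2 ⟨?_, ?_⟩
    · have : Tendsto (fun k : ℝ => k ^ 2) (𝓝 1) (𝓝 (1 ^ 2)) :=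
        (continuous_pow 2).tendsto 1
      rw [one_pow] at this
      exact this.mono_left nhdsWithin_le_nhds
    · filter_upwards [Ioo_mem_nhdsLT (zero_lt_one' ℝ)] with k hk
      have := hk.1
      have := hk.2
      exact Set.mem_Iio.2 (by nlinarith)
  have hb : Tendsto (fun k : ℝ => -(1 - k) ^ 2 / (4 * k)) (𝓝[<] 1) (𝓝 0) := by
    have : ContinuousAt (fun k : ℝ => -(1 - k) ^ 2 / (4 * k)) 1 := by
      refine ContinuousAt.div (by fun_prop) (by fun_prop) (by norm_num)
    have := this.tendsto
    simp only [sub_self] at this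
    exact (this.mono_left nhdsWithin_le_nhds).trans (by norm_num)
  have hc : Tendsto (fun k : ℝ => -(1 - k) / (1 + k)) (𝓝[<] 1) (𝓝 0) := by
    have : ContinuousAt (fun k : ℝ => -(1 - k) / (1 + k)) 1 := by
      refine ContinuousAt.div (by fun_prop) (by fun_prop) (by norm_num)
    have := this.tendsto
    simp only [sub_self] at this
    exact (this.mono_left nhdsWithin_le_nhds).trans (by norm_num)
  have F0 : ellF 0 = 1 := by
    rw [ellF, powerSum, tsum_eq_single 0 (fun n hn => by simp [hn])]
    simp [ellCoeff, halfBinom_zero]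
  have Fb := ((analyticAt_ellF (u := 0) (by simp)).continuousAt.tendsto).comp hb
  have Qb := ((continuousAt_ellQ (u := 0) (by simp)).tendsto).comp hb
  have Pa := tendsto_ellP.comp ha
  have Fa := tendsto_one_sub_mul_ellF.comp ha
  rw [F0] at Fb
  have h := (((Pa.const_mul 2).mul Fb).add ((Fa.const_mul (1 / 2)).mul Fb)).add
    ((Fa.mul hc).mul Qb)
  have e : 2 * (1 / π) * 1 + 1 / 2 * 0 * 1 + 0 * 0 * ellQ 0 = 2 / π := by ring
  rw [e] at h
  refine h.congr' ?_
  filter_upwards [Ioo_mem_nhdsLT (zero_lt_one' ℝ)] with k hk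
  have hk0 : k ≠ 0 := hk.1.ne'
  have h1k : 1 + k ≠ 0 := by linarith [hk.1]
  simp only [Function.comp, legendreForm, ellP]
  field_simp
  ring

/-- **Legendre's relation** for complete elliptic integrals, in hypergeometric form after a Landen
and a Pfaff transformation of the complementary integral. -/
theorem legendreForm_eq {k : ℝ} (hk0 : 7 / 40 < k) (hk1 : k < 1) :
    legendreForm k = 2 * √k / π := by
  have hd : ∀ y ∈ Set.Ioo (7 / 40 : ℝ) 1, HasDerivAt (fun y => legendreForm y / √y) 0 y := by
    intro y hy
    have hy0 : 0 < y := by linarith [hy.1]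
    have hs : √y ≠ 0 := (Real.sqrt_pos.2 hy0).ne'
    refine ((hasDerivAt_legendreForm hy.1 hy.2).div (Real.hasDerivAt_sqrt hy0.ne') hs).congr_deriv
      ?_
    have := Real.sq_sqrt hy0.le
    rw [div_eq_zero_iff]
    left
    generalize legendreForm y = L
    field_simp
    rw [this]
    ring
  obtain ⟨a, ha⟩ := isOpen_Ioo.exists_is_const_of_deriv_eq_zero isPreconnected_Ioo
    (fun y hy => (hd y hy).differentiableAt.differentiableWithinAt) (fun y hy => (hd y hy).deriv)
  have hlim : Tendsto (fun y => legendreForm y / √y) (nhdsWithin 1 (Set.Iio 1))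
      (nhds (2 / π / √1)) :=
    tendsto_legendreForm.div ((Real.continuous_sqrt.tendsto 1).mono_left nhdsWithin_le_nhds)
      (by simp)
  have hconst : Tendsto (fun y => legendreForm y / √y) (nhdsWithin 1 (Set.Iio 1)) (nhds a) := by
    refine tendsto_const_nhds.congr' ?_
    filter_upwards [Ioo_mem_nhdsLT (show (7 / 40 : ℝ) < 1 by norm_num)] with y hy
    exact (ha y hy).symm
  have h1 := tendsto_nhds_unique hlim hconst
  have h2 := ha k ⟨hk0, hk1⟩
  have hs : √k ≠ 0 := (Real.sqrt_pos.2 (by linarith)).ne'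
  rw [← h1, Real.sqrt_one, div_one, div_eq_iff hs] at h2
  rw [h2]
  ring

lemma tsum_eq_tsum_sum_of_mem_iff {α β : Type*} {g : α → ℝ} (hg : Summable g) (φ : α → β)
    (s : β → Finset α) (hs : ∀ b a, a ∈ s b ↔ φ a = b) :
    ∑' a, g a = ∑' b, ∑ a ∈ s b, g a := by
  rw [← (hg.hasSum.tsum_fiberwise φ).tsum_eq]
  refine tsum_congr fun b => ?_
  have : φ ⁻¹' {b} = ↑(s b) := by
    ext a
    simp [hs]
  rw [this]
  exact Finset.tsum_subtype (s b) g

lemma hasSum_choose_mul_choose (i j : ℕ) (a b : ℝ) :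
    HasSum (fun w : ℕ × ℕ => j.choose w.1 * a ^ w.1 * (i.choose w.2 * b ^ w.2))
      ((1 + a) ^ j * (1 + b) ^ i) := by
  have e : (1 + a) ^ j * (1 + b) ^ i = ∑ w ∈ Finset.range (j + 1) ×ˢ Finset.range (i + 1),
      j.choose w.1 * a ^ w.1 * (i.choose w.2 * b ^ w.2) := by
    simp only [Finset.sum_product]
    rw [← Finset.sum_mul_sum, add_comm 1 a, add_comm 1 b, add_pow, add_pow]
    simp only [one_pow, mul_one]
    congr 1 <;> exact Finset.sum_congr rfl fun _ _ => mul_comm _ _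
  rw [e]
  refine hasSum_sum_of_ne_finset_zero fun w hw => ?_
  rw [Finset.mem_product, Finset.mem_range, Finset.mem_range, not_and_or] at hw
  rcases hw with hw | hw
  · simp [Nat.choose_eq_zero_of_lt (show j < w.1 by omega)]
  · simp [Nat.choose_eq_zero_of_lt (show i < w.2 by omega)]

/-- The coefficients of the two-variable series in Bailey's reduction formula. -/
noncomputable def baileyCoeff (x : ℕ × ℕ) : ℝ :=
  halfBinom (x.1 + x.2) ^ 2 * ((x.1 + x.2).choose x.1 : ℝ) ^ 2

lemma baileyCoeff_nonneg (x : ℕ × ℕ) : 0 ≤ baileyCoeff x := by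
  unfold baileyCoeff
  positivity

lemma halfBinom_le_one (n : ℕ) : halfBinom n ≤ 1 := by
  induction n with
  | zero => rw [halfBinom_zero]
  | succ n ih =>
    have h := succ_mul_halfBinom_succ n
    have := (halfBinom_pos n).le
    have : (0 : ℝ) ≤ n := n.cast_nonneg
    nlinarith

lemma baileyCoeff_le (x : ℕ × ℕ) : baileyCoeff x ≤ 4 ^ x.1 * 4 ^ x.2 := by
  have h1 : ((x.1 + x.2).choose x.1 : ℝ) ≤ 2 ^ (x.1 + x.2) := by
    exact_mod_cast Nat.choose_le_two_pow _ _
  have h2 := halfBinom_le_one (x.1 + x.2)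
  have h3 := (halfBinom_pos (x.1 + x.2)).le
  calc baileyCoeff x ≤ 1 ^ 2 * (2 ^ (x.1 + x.2)) ^ 2 := by
        unfold baileyCoeff
        gcongr
    _ = 4 ^ x.1 * 4 ^ x.2 := by
        rw [← pow_mul, mul_comm _ 2, pow_mul, pow_add]
        norm_num

lemma summable_baileyCoeff {a b : ℝ} (ha0 : 0 ≤ a) (ha : 4 * a < 1) (hb0 : 0 ≤ b)
    (hb : 4 * b < 1) : Summable fun x : ℕ × ℕ => baileyCoeff x * a ^ x.1 * b ^ x.2 := by
  refine Summable.of_nonneg_of_le (fun x => ?_) (fun x => ?_)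
    ((summable_geometric_of_lt_one (by positivity) ha).mul_of_nonneg
      (summable_geometric_of_lt_one (by positivity) hb)
      (fun _ => by positivity) (fun _ => by positivity))
  · have := baileyCoeff_nonneg x
    positivity
  · calc baileyCoeff x * a ^ x.1 * b ^ x.2 ≤ 4 ^ x.1 * 4 ^ x.2 * a ^ x.1 * b ^ x.2 := by
          gcongr
          exact baileyCoeff_le x
      _ = _ := by
          rw [mul_pow, mul_pow]
          ring

/-- The terms of the quadruple series whose two groupings give Bailey's reduction formula. -/
noncomputable def baileyTerm (a b : ℝ) (t : (ℕ × ℕ) × (ℕ × ℕ)) : ℝ :=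
  baileyCoeff t.1 * a ^ t.1.1 * b ^ t.1.2 *
    (t.1.2.choose t.2.1 * (-a) ^ t.2.1 * (t.1.1.choose t.2.2 * (-b) ^ t.2.2))

lemma hasSum_baileyTerm (a b : ℝ) (x : ℕ × ℕ) :
    HasSum (fun w => baileyTerm a b (x, w))
      (baileyCoeff x * (a * (1 - b)) ^ x.1 * (b * (1 - a)) ^ x.2) := by
  have h := (hasSum_choose_mul_choose x.1 x.2 (-a) (-b)).mul_left
    (baileyCoeff x * a ^ x.1 * b ^ x.2)
  convert! h using 1
  rw [mul_pow, mul_pow]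
  ring

lemma abs_baileyTerm (a b : ℝ) (x w : ℕ × ℕ) :
    |baileyTerm a b (x, w)| = baileyCoeff x * |a| ^ x.1 * |b| ^ x.2 *
      (x.2.choose w.1 * |a| ^ w.1 * (x.1.choose w.2 * |b| ^ w.2)) := by
  simp only [baileyTerm, abs_mul, abs_pow, abs_neg, Nat.abs_cast,
    abs_of_nonneg (baileyCoeff_nonneg x)]

lemma summable_baileyTerm {a b : ℝ} (ha : |a| ≤ 1 / 10) (hb : |b| ≤ 1 / 10) :
    Summable (baileyTerm a b) := by
  refine Summable.of_abs ?_
  have hs : ∀ x : ℕ × ℕ, HasSum (fun w => |baileyTerm a b (x, w)|)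
      (baileyCoeff x * (|a| * (1 + |b|)) ^ x.1 * (|b| * (1 + |a|)) ^ x.2) := by
    intro x
    have h := (hasSum_choose_mul_choose x.1 x.2 |a| |b|).mul_left
      (baileyCoeff x * |a| ^ x.1 * |b| ^ x.2)
    simp only [abs_baileyTerm]
    convert! h using 1
    rw [mul_pow, mul_pow]
    ring
  refine (summable_prod_of_nonneg fun _ => abs_nonneg _).2 ⟨fun x => (hs x).summable, ?_⟩
  simp only [(hs _).tsum_eq]
  have ha0 := abs_nonneg a
  have hb0 := abs_nonneg b
  refine summable_baileyCoeff (by positivity) ?_ (by positivity) ?_ <;> nlinarith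

lemma sum_product_antidiagonal_baileyTerm (a b : ℝ) (p q : ℕ) :
    ∑ z ∈ Finset.HasAntidiagonal.antidiagonal p ×ˢ Finset.HasAntidiagonal.antidiagonal q,
      baileyTerm a b (Equiv.prodProdProdComm ℕ ℕ ℕ ℕ z) =
      (ellCoeff p * a ^ p) * (ellCoeff q * b ^ q) := by
  have h := sum_antidiagonal_bailey p q
  rw [Finset.sum_product, ellCoeff, ellCoeff,
    show halfBinom p ^ 2 * a ^ p * (halfBinom q ^ 2 * b ^ q) =
      a ^ p * b ^ q * (halfBinom p ^ 2 * halfBinom q ^ 2) by ring, ← h, Finset.mul_sum]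
  refine Finset.sum_congr rfl fun x hx => ?_
  rw [Finset.mul_sum]
  refine Finset.sum_congr rfl fun y hy => ?_
  rw [← Finset.HasAntidiagonal.mem_antidiagonal.1 hx,
    ← Finset.HasAntidiagonal.mem_antidiagonal.1 hy]
  simp only [Equiv.prodProdProdComm_apply, baileyTerm, baileyCoeff]
  rw [neg_pow a, neg_pow b, pow_add, pow_add]
  ring

/-- **Bailey's reduction formula**, for small arguments. -/
theorem tsum_sum_antidiagonal_baileyCoeff {a b : ℝ} (ha : |a| ≤ 1 / 10) (hb : |b| ≤ 1 / 10) :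
    ∑' n, ∑ x ∈ Finset.HasAntidiagonal.antidiagonal n,
      baileyCoeff x * (a * (1 - b)) ^ x.1 * (b * (1 - a)) ^ x.2 = ellF a * ellF b := by
  have hs := summable_baileyTerm ha hb
  have hx : Summable fun x : ℕ × ℕ =>
      baileyCoeff x * (a * (1 - b)) ^ x.1 * (b * (1 - a)) ^ x.2 := by
    have := hs.prod
    simpa only [(hasSum_baileyTerm a b _).tsum_eq] using this
  have h1 := hs.tsum_prod
  simp only [(hasSum_baileyTerm a b _).tsum_eq] at h1
  rw [tsum_eq_tsum_sum_of_mem_iff hx (fun x => x.1 + x.2) Finset.HasAntidiagonal.antidiagonal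
    (fun _ _ => Finset.HasAntidiagonal.mem_antidiagonal)] at h1
  have hs' : Summable fun z => baileyTerm a b (Equiv.prodProdProdComm ℕ ℕ ℕ ℕ z) :=
    (Equiv.prodProdProdComm ℕ ℕ ℕ ℕ).summable_iff.2 hs
  rw [← h1, ← (Equiv.prodProdProdComm ℕ ℕ ℕ ℕ).tsum_eq,
    tsum_eq_tsum_sum_of_mem_iff hs'
      (fun z => (z.1.1 + z.1.2, z.2.1 + z.2.2))
      (fun b => Finset.HasAntidiagonal.antidiagonal b.1 ×ˢ
        Finset.HasAntidiagonal.antidiagonal b.2) (fun b z => by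
        simp [Finset.mem_product, Finset.HasAntidiagonal.mem_antidiagonal, Prod.ext_iff])]
  have ha1 : |a| < 1 := by linarith
  have hb1 : |b| < 1 := by linarith
  simp only [sum_product_antidiagonal_baileyTerm]
  exact (tsum_mul_tsum_of_summable_norm (unitDiscSummable_ellCoeff.summable ha1).norm
    (unitDiscSummable_ellCoeff.summable hb1).norm).symm

lemma ellCoeff_mul_legendreP_mul_pow (n : ℕ) {a b x : ℝ} (hx : x * (b - a) = a + b - 2 * a * b) :
    ellCoeff n * legendreP n x * (b - a) ^ n = ∑ y ∈ Finset.HasAntidiagonal.antidiagonal n,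
      baileyCoeff y * (a * (1 - b)) ^ y.1 * (b * (1 - a)) ^ y.2 := by
  rw [legendreP_eq_sum, Finset.Nat.sum_antidiagonal_eq_sum_range_succ_mk, Finset.mul_sum,
    Finset.sum_mul, ← Finset.sum_range_reflect, Nat.add_sub_cancel]
  refine Finset.sum_congr rfl fun j hj => ?_
  have hj' : j ≤ n := Nat.lt_succ_iff.1 (Finset.mem_range.1 hj)
  have h1 : a * (1 - b) = (x - 1) / 2 * (b - a) := by linear_combination -hx / 2
  have h2 : b * (1 - a) = (x + 1) / 2 * (b - a) := by linear_combination -hx / 2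
  have h3 : (b - a) ^ n = (b - a) ^ j * (b - a) ^ (n - j) := by
    rw [← pow_add, Nat.add_sub_cancel' hj']
  simp only [Nat.choose_symm hj', Nat.sub_sub_self hj', baileyCoeff,
    Nat.add_sub_cancel' hj', ellCoeff]
  rw [h1, h2, mul_pow, mul_pow, h3]
  ring

/-- **Brafman's formula** at a pair of small arguments. -/
lemma powerSum_ellCoeff_mul_legendreP_of_small {a b x : ℝ} (ha : |a| ≤ 1 / 10) (hb : |b| ≤ 1 / 10)
    (hx : x * (b - a) = a + b - 2 * a * b) :
    powerSum (fun n => ellCoeff n * legendreP n x) (b - a) = ellF a * ellF b := by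
  rw [← tsum_sum_antidiagonal_baileyCoeff ha hb]
  exact tsum_congr fun n => ellCoeff_mul_legendreP_mul_pow n hx

/-- The generating-function radical `√(1 - 2xz + z²)`. -/
noncomputable def brafmanRho (x z : ℝ) : ℝ := √(1 - 2 * x * z + z ^ 2)

/-- The first argument in Brafman's formula. -/
noncomputable def brafmanA (x z : ℝ) : ℝ := (1 - brafmanRho x z - z) / 2

/-- The second argument in Brafman's formula. -/
noncomputable def brafmanB (x z : ℝ) : ℝ := (1 - brafmanRho x z + z) / 2

section Brafman

variable {x z : ℝ}

lemma brafman_radicand_pos (hx : |x| < 1) (z : ℝ) : 0 < 1 - 2 * x * z + z ^ 2 := by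
  have := (sq_lt_one_iff_abs_lt_one x).2 hx
  nlinarith [sq_nonneg (z - x)]

lemma brafmanRho_pos (hx : |x| < 1) (z : ℝ) : 0 < brafmanRho x z :=
  Real.sqrt_pos.2 (brafman_radicand_pos hx z)

lemma brafmanRho_sq (hx : |x| < 1) (z : ℝ) : brafmanRho x z ^ 2 = 1 - 2 * x * z + z ^ 2 :=
  Real.sq_sqrt (brafman_radicand_pos hx z).le

lemma abs_one_sub_brafmanRho_le (hx : |x| < 1) (z : ℝ) : |1 - brafmanRho x z| ≤ |z| := by
  have h1 : |x * z| ≤ |z| := by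
    rw [abs_mul]
    exact mul_le_of_le_one_left (abs_nonneg z) hx.le
  have h2 := abs_le.1 h1
  have h3 := sq_abs z
  have h4 := abs_nonneg z
  rw [abs_le]
  constructor
  · have : brafmanRho x z ≤ 1 + |z| := Real.sqrt_le_iff.2 ⟨by linarith, by nlinarith⟩
    linarith
  · have : 1 - |z| ≤ brafmanRho x z := Real.le_sqrt_of_sq_le (by nlinarith)
    linarith

lemma abs_brafmanA_le (hx : |x| < 1) (z : ℝ) : |brafmanA x z| ≤ |z| := by
  rw [brafmanA, abs_div, abs_two, div_le_iff₀ two_pos]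
  have := abs_one_sub_brafmanRho_le hx z
  linarith [abs_sub (1 - brafmanRho x z) z]

lemma abs_brafmanB_le (hx : |x| < 1) (z : ℝ) : |brafmanB x z| ≤ |z| := by
  rw [brafmanB, abs_div, abs_two, div_le_iff₀ two_pos]
  have := abs_one_sub_brafmanRho_le hx z
  linarith [abs_add_le (1 - brafmanRho x z) z]

lemma brafmanB_sub_brafmanA : brafmanB x z - brafmanA x z = z := by
  rw [brafmanA, brafmanB]
  ring

lemma mul_brafmanB_sub_brafmanA (hx : |x| < 1) : x * (brafmanB x z - brafmanA x z) =
    brafmanA x z + brafmanB x z - 2 * brafmanA x z * brafmanB x z := by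
  rw [brafmanA, brafmanB]
  linear_combination brafmanRho_sq hx z / 2

lemma analyticAt_brafmanRho (hx : |x| < 1) (z : ℝ) : AnalyticAt ℝ (brafmanRho x) z := by
  have h1 : AnalyticAt ℝ (fun u : ℝ => √u) (1 - 2 * x * z + z ^ 2) :=
    (Real.contDiffAt_sqrt (brafman_radicand_pos hx z).ne').analyticAt
  have h2 : AnalyticAt ℝ (fun z : ℝ => 1 - 2 * x * z + z ^ 2) z := by fun_prop
  exact AnalyticAt.comp (g := fun u : ℝ => √u) (f := fun z => 1 - 2 * x * z + z ^ 2) h1 h2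

lemma unitDiscSummable_ellCoeff_mul_legendreP (hx : |x| < 1) :
    UnitDiscSummable fun n => ellCoeff n * legendreP n x := by
  refine unitDiscSummable_of_abs_le (K := 1) fun n => ?_
  rw [abs_mul, abs_of_nonneg (ellCoeff_nonneg n)]
  have h1 : ellCoeff n ≤ 1 := pow_le_one₀ (halfBinom_pos n).le (halfBinom_le_one n)
  exact mul_le_one₀ h1 (abs_nonneg _) (abs_legendreP_le_one n hx)

/-- **Brafman's formula**. -/
theorem powerSum_ellCoeff_mul_legendreP (hx : |x| < 1) (hz : |z| < 1) :
    powerSum (fun n => ellCoeff n * legendreP n x) z =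
      ellF (brafmanA x z) * ellF (brafmanB x z) := by
  have hG : AnalyticOnNhd ℝ (powerSum fun n => ellCoeff n * legendreP n x) (Set.Ioo (-1) 1) :=
    fun y hy => (unitDiscSummable_ellCoeff_mul_legendreP hx).analyticAt (abs_lt.2 hy)
  have hH : AnalyticOnNhd ℝ (fun z => ellF (brafmanA x z) * ellF (brafmanB x z))
      (Set.Ioo (-1) 1) := by
    intro y hy
    have hy' := abs_lt.2 hy
    have hρ := analyticAt_brafmanRho hx y
    have hA : AnalyticAt ℝ (brafmanA x) y := by
      unfold brafmanA
      fun_prop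
    have hB : AnalyticAt ℝ (brafmanB x) y := by
      unfold brafmanB
      fun_prop
    have h1 := (analyticAt_ellF ((abs_brafmanA_le hx y).trans_lt hy')).comp hA
    have h2 := (analyticAt_ellF ((abs_brafmanB_le hx y).trans_lt hy')).comp hB
    exact h1.mul h2
  refine hG.eqOn_of_preconnected_of_eventuallyEq hH isPreconnected_Ioo
    (z₀ := 0) (by simp) ?_ (abs_lt.1 hz)
  filter_upwards [Metric.closedBall_mem_nhds (0 : ℝ) (show (0 : ℝ) < 1 / 10 by norm_num)] with y hy
  have hy1 : |y| ≤ 1 / 10 := by simpa using hy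
  have hy2 : |y| < 1 := by linarith
  have h := powerSum_ellCoeff_mul_legendreP_of_small ((abs_brafmanA_le hx y).trans hy1)
    ((abs_brafmanB_le hx y).trans hy1) (mul_brafmanB_sub_brafmanA hx)
  rwa [brafmanB_sub_brafmanA] at h

/-- `f` is differentiable at `z` and `d` is `z` times its derivative there. -/
def HasEulerDerivAt (f : ℝ → ℝ) (d z : ℝ) : Prop := ∃ f', HasDerivAt f f' z ∧ d = z * f'

namespace HasEulerDerivAt

variable {f g : ℝ → ℝ} {a b : ℝ}

lemma congr_deriv (hf : HasEulerDerivAt f a z) (h : a = b) : HasEulerDerivAt f b z := h ▸ hf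

lemma congr_fun_deriv (hf : HasEulerDerivAt f a z) (hfg : ∀ y, f y = g y) (h : a = b) :
    HasEulerDerivAt g b z := by
  rwa [← funext hfg, ← h]

lemma add (hf : HasEulerDerivAt f a z) (hg : HasEulerDerivAt g b z) :
    HasEulerDerivAt (fun y => f y + g y) (a + b) z := by
  obtain ⟨f', hf', rfl⟩ := hf
  obtain ⟨g', hg', rfl⟩ := hg
  exact ⟨_, hf'.add hg', by ring⟩

lemma const_mul (c : ℝ) (hf : HasEulerDerivAt f a z) :
    HasEulerDerivAt (fun y => c * f y) (c * a) z := by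
  obtain ⟨f', hf', rfl⟩ := hf
  exact ⟨_, hf'.const_mul c, by ring⟩

lemma mul (hf : HasEulerDerivAt f a z) (hg : HasEulerDerivAt g b z) :
    HasEulerDerivAt (fun y => f y * g y) (a * g z + f z * b) z := by
  obtain ⟨f', hf', rfl⟩ := hf
  obtain ⟨g', hg', rfl⟩ := hg
  exact ⟨_, hf'.mul hg', by ring⟩

lemma div (hf : HasEulerDerivAt f a z) (hg : HasEulerDerivAt g b z) (h : g z ≠ 0) :
    HasEulerDerivAt (fun y => f y / g y) ((a * g z - f z * b) / g z ^ 2) z := by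
  obtain ⟨f', hf', rfl⟩ := hf
  obtain ⟨g', hg', rfl⟩ := hg
  exact ⟨_, hf'.div hg' h, by ring⟩

lemma pow (hf : HasEulerDerivAt f a z) (n : ℕ) :
    HasEulerDerivAt (fun y => f y ^ n) (n * f z ^ (n - 1) * a) z := by
  obtain ⟨f', hf', rfl⟩ := hf
  exact ⟨_, hf'.pow n, by ring⟩

lemma comp {φ : ℝ → ℝ} {φ' : ℝ} (hφ : HasDerivAt φ φ' (f z)) (hf : HasEulerDerivAt f a z) :
    HasEulerDerivAt (fun y => φ (f y)) (φ' * a) z := by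
  obtain ⟨f', hf', rfl⟩ := hf
  exact ⟨_, HasDerivAt.comp (h₂ := φ) z hφ hf', by ring⟩

end HasEulerDerivAt

lemma powerSum_natCast_mul_eq {c : ℕ → ℝ} (hc : UnitDiscSummable c) {H : ℝ → ℝ} {d : ℝ}
    (hH : ∀ y, |y| < 1 → powerSum c y = H y) (hz : |z| < 1) (hd : HasEulerDerivAt H d z) :
    powerSum (fun n => n * c n) z = d := by
  obtain ⟨d', hd', rfl⟩ := hd
  obtain ⟨e, he, hze⟩ := hc.exists_hasDerivAt hz
  have : powerSum c =ᶠ[nhds z] H := by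
    filter_upwards [isOpen_Ioo.mem_nhds (abs_lt.1 hz)] with y hy
    exact hH y (abs_lt.2 hy)
  rw [← hze, he.unique (hd'.congr_of_eventuallyEq this)]

lemma hasEulerDerivAt_brafmanRho (hx : |x| < 1) (z : ℝ) : HasEulerDerivAt (brafmanRho x)
    (-(brafmanA x z * (1 - brafmanA x z) + brafmanB x z * (1 - brafmanB x z)) /
      brafmanRho x z) z := by
  have h0 : HasDerivAt (fun z : ℝ => 1 - 2 * x * z + z ^ 2) (-(2 * x) + 2 * z) z := by
    refine ((((hasDerivAt_id z).const_mul (2 * x)).const_sub 1).add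
      (hasDerivAt_pow 2 z)).congr_deriv ?_
    simp
  refine ⟨_, h0.sqrt (brafman_radicand_pos hx z).ne', ?_⟩
  change _ = z * ((-(2 * x) + 2 * z) / (2 * brafmanRho x z))
  have hρ := brafmanRho_pos hx z
  have h2 := brafmanRho_sq hx z
  rw [brafmanA, brafmanB]
  field_simp
  linear_combination 2 * h2

lemma hasEulerDerivAt_id (z : ℝ) : HasEulerDerivAt (fun y => y) z z :=
  ⟨1, hasDerivAt_id z, by ring⟩

lemma hasEulerDerivAt_const (c z : ℝ) : HasEulerDerivAt (fun _ => c) 0 z :=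
  ⟨0, hasDerivAt_const z c, by ring⟩

lemma hasEulerDerivAt_brafmanA (hx : |x| < 1) (z : ℝ) : HasEulerDerivAt (brafmanA x)
    (brafmanA x z * (1 - brafmanA x z) / brafmanRho x z) z := by
  have h := (((hasEulerDerivAt_const 1 z).add
    ((hasEulerDerivAt_brafmanRho hx z).const_mul (-1))).add
    ((hasEulerDerivAt_id z).const_mul (-1))).const_mul (1 / 2)
  have e : (fun y => 1 / 2 * (1 + -1 * brafmanRho x y + -1 * y)) = brafmanA x := by
    ext y
    rw [brafmanA]
    ring
  rw [e] at h
  refine h.congr_deriv ?_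
  have hρ := brafmanRho_pos hx z
  have h2 := brafmanRho_sq hx z
  rw [brafmanA, brafmanB]
  field_simp
  ring

lemma hasEulerDerivAt_brafmanB (hx : |x| < 1) (z : ℝ) : HasEulerDerivAt (brafmanB x)
    (brafmanB x z * (1 - brafmanB x z) / brafmanRho x z) z := by
  have h := (hasEulerDerivAt_brafmanA hx z).add (hasEulerDerivAt_id z)
  have e : (fun y => brafmanA x y + y) = brafmanB x := by
    ext y
    rw [brafmanA, brafmanB]
    ring
  rw [e] at h
  refine h.congr_deriv ?_
  have hρ := brafmanRho_pos hx z
  rw [brafmanA, brafmanB]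
  field_simp
  ring

lemma HasEulerDerivAt.ellF_comp {f : ℝ → ℝ} {r : ℝ} (h : |f z| < 1)
    (hf : HasEulerDerivAt f (f z * (1 - f z) / r) z) :
    HasEulerDerivAt (fun y => ellF (f y)) (ellP (f z) / r) z := by
  refine (HasEulerDerivAt.comp (hasDerivAt_ellF h) hf).congr_deriv ?_
  rw [← mul_one_sub_mul_ellF' h]
  ring

lemma HasEulerDerivAt.ellP_comp {f : ℝ → ℝ} {r : ℝ} (h : |f z| < 1)
    (hf : HasEulerDerivAt f (f z * (1 - f z) / r) z) :
    HasEulerDerivAt (fun y => ellP (f y)) (f z * (1 - f z) * ellF (f z) / (4 * r)) z := by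
  refine (HasEulerDerivAt.comp (hasDerivAt_ellP h) hf).congr_deriv ?_
  ring

/-- The Euler derivative of `brafmanRho` is `-brafmanS / brafmanRho`. -/
noncomputable def brafmanS (x y : ℝ) : ℝ :=
  brafmanA x y * (1 - brafmanA x y) + brafmanB x y * (1 - brafmanB x y)

/-- The Euler derivative of the right side of Brafman's formula, times `brafmanRho`. -/
noncomputable def brafmanW (x y : ℝ) : ℝ :=
  ellP (brafmanA x y) * ellF (brafmanB x y) + ellF (brafmanA x y) * ellP (brafmanB x y)

/-- The Euler derivative of `brafmanW`, times `brafmanRho`. -/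
noncomputable def brafmanV (x y : ℝ) : ℝ :=
  1 / 4 * (brafmanS x y * (ellF (brafmanA x y) * ellF (brafmanB x y))) +
    2 * (ellP (brafmanA x y) * ellP (brafmanB x y))

/-- The Euler derivative of `brafmanS`, times `brafmanRho`. -/
noncomputable def brafmanT (x y : ℝ) : ℝ :=
  brafmanA x y * (1 - brafmanA x y) * (1 - 2 * brafmanA x y) +
    brafmanB x y * (1 - brafmanB x y) * (1 - 2 * brafmanB x y)

/-- The Euler derivative of `brafmanV`, times `brafmanRho`. -/
noncomputable def brafmanU (x y : ℝ) : ℝ :=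
  1 / 4 * (brafmanT x y * (ellF (brafmanA x y) * ellF (brafmanB x y)) +
    brafmanS x y * brafmanW x y) +
    1 / 2 * (brafmanA x y * (1 - brafmanA x y) * (ellF (brafmanA x y) * ellP (brafmanB x y)) +
      brafmanB x y * (1 - brafmanB x y) * (ellP (brafmanA x y) * ellF (brafmanB x y)))

lemma hasEulerDerivAt_brafmanS (hx : |x| < 1) (z : ℝ) :
    HasEulerDerivAt (brafmanS x) (brafmanT x z / brafmanRho x z) z := by
  have hA := hasEulerDerivAt_brafmanA hx z
  have hB := hasEulerDerivAt_brafmanB hx z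
  have h1 := hasEulerDerivAt_const 1 z
  refine ((hA.mul (h1.add (hA.const_mul (-1)))).add
    (hB.mul (h1.add (hB.const_mul (-1))))).congr_fun_deriv (fun y => ?_) ?_
  · rw [brafmanS]
    ring
  · rw [brafmanT]
    ring

lemma hasEulerDerivAt_ellF_brafmanA (hx : |x| < 1) (hz : |z| < 1) :
    HasEulerDerivAt (fun y => ellF (brafmanA x y)) (ellP (brafmanA x z) / brafmanRho x z) z :=
  .ellF_comp ((abs_brafmanA_le hx z).trans_lt hz) (hasEulerDerivAt_brafmanA hx z)

lemma hasEulerDerivAt_ellF_brafmanB (hx : |x| < 1) (hz : |z| < 1) :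
    HasEulerDerivAt (fun y => ellF (brafmanB x y)) (ellP (brafmanB x z) / brafmanRho x z) z :=
  .ellF_comp ((abs_brafmanB_le hx z).trans_lt hz) (hasEulerDerivAt_brafmanB hx z)

lemma hasEulerDerivAt_ellF_mul_ellF (hx : |x| < 1) (hz : |z| < 1) :
    HasEulerDerivAt (fun y => ellF (brafmanA x y) * ellF (brafmanB x y))
      (brafmanW x z / brafmanRho x z) z := by
  refine ((hasEulerDerivAt_ellF_brafmanA hx hz).mul
    (hasEulerDerivAt_ellF_brafmanB hx hz)).congr_deriv ?_
  rw [brafmanW]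
  ring

lemma hasEulerDerivAt_brafmanW (hx : |x| < 1) (hz : |z| < 1) :
    HasEulerDerivAt (brafmanW x) (brafmanV x z / brafmanRho x z) z := by
  have hPA := HasEulerDerivAt.ellP_comp ((abs_brafmanA_le hx z).trans_lt hz)
    (hasEulerDerivAt_brafmanA hx z)
  have hPB := HasEulerDerivAt.ellP_comp ((abs_brafmanB_le hx z).trans_lt hz)
    (hasEulerDerivAt_brafmanB hx z)
  refine ((hPA.mul (hasEulerDerivAt_ellF_brafmanB hx hz)).add
    ((hasEulerDerivAt_ellF_brafmanA hx hz).mul hPB)).congr_fun_deriv (fun y => ?_) ?_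
  · rw [brafmanW]
  · have hρ := brafmanRho_pos hx z
    rw [brafmanV, brafmanS]
    field_simp
    ring

lemma hasEulerDerivAt_brafmanV (hx : |x| < 1) (hz : |z| < 1) :
    HasEulerDerivAt (brafmanV x) (brafmanU x z / brafmanRho x z) z := by
  have hPA := HasEulerDerivAt.ellP_comp ((abs_brafmanA_le hx z).trans_lt hz)
    (hasEulerDerivAt_brafmanA hx z)
  have hPB := HasEulerDerivAt.ellP_comp ((abs_brafmanB_le hx z).trans_lt hz)
    (hasEulerDerivAt_brafmanB hx z)
  refine ((((hasEulerDerivAt_brafmanS hx z).mul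
    (hasEulerDerivAt_ellF_mul_ellF hx hz)).const_mul (1 / 4)).add
    ((hPA.mul hPB).const_mul 2)).congr_fun_deriv (fun y => ?_) ?_
  · rw [brafmanV]
  · have hρ := brafmanRho_pos hx z
    rw [brafmanU]
    field_simp
    ring

lemma powerSum_natCast_mul_brafman (hx : |x| < 1) (hz : |z| < 1) :
    powerSum (fun n => n * (ellCoeff n * legendreP n x)) z = brafmanW x z / brafmanRho x z :=
  powerSum_natCast_mul_eq (unitDiscSummable_ellCoeff_mul_legendreP hx)
    (fun _ hy => powerSum_ellCoeff_mul_legendreP hx hy) hz (hasEulerDerivAt_ellF_mul_ellF hx hz)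

lemma powerSum_natCast_mul_natCast_mul_brafman (hx : |x| < 1) (hz : |z| < 1) :
    powerSum (fun n => n * (n * (ellCoeff n * legendreP n x))) z =
      brafmanV x z / brafmanRho x z ^ 2 + brafmanW x z * brafmanS x z / brafmanRho x z ^ 3 := by
  have hρ := brafmanRho_pos hx z
  refine powerSum_natCast_mul_eq (unitDiscSummable_ellCoeff_mul_legendreP hx).natCast_mul
    (fun _ hy => powerSum_natCast_mul_brafman hx hy) hz
    (((hasEulerDerivAt_brafmanW hx hz).div (hasEulerDerivAt_brafmanRho hx z)
      hρ.ne').congr_deriv ?_)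
  rw [← brafmanS]
  field_simp
  ring

lemma powerSum_natCast_mul_natCast_mul_natCast_mul_brafman (hx : |x| < 1) (hz : |z| < 1) :
    powerSum (fun n => n * (n * (n * (ellCoeff n * legendreP n x)))) z =
      brafmanU x z / brafmanRho x z ^ 3 +
        3 * brafmanS x z * brafmanV x z / brafmanRho x z ^ 4 +
        brafmanW x z * (brafmanT x z / brafmanRho x z ^ 4 +
          3 * brafmanS x z ^ 2 / brafmanRho x z ^ 5) := by
  have hρ := brafmanRho_pos hx z
  have hr := hasEulerDerivAt_brafmanRho hx z
  refine powerSum_natCast_mul_eq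
    (unitDiscSummable_ellCoeff_mul_legendreP hx).natCast_mul.natCast_mul
    (fun _ hy => powerSum_natCast_mul_natCast_mul_brafman hx hy) hz
    ((((hasEulerDerivAt_brafmanV hx hz).div (hr.pow 2) (by positivity)).add
      (((hasEulerDerivAt_brafmanW hx hz).mul (hasEulerDerivAt_brafmanS hx z)).div
      (hr.pow 3) (by positivity))).congr_deriv ?_)
  rw [← brafmanS]
  field_simp
  ring

end Brafman

lemma UnitDiscSummable.hasSum_mul_cubic {c : ℕ → ℝ} (h : UnitDiscSummable c) {u : ℝ}
    (hu : |u| < 1) (C₃ C₂ C₁ C₀ : ℝ) :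
    HasSum (fun n : ℕ => c n * u ^ n * (C₃ * (n : ℝ) ^ 3 + C₂ * (n : ℝ) ^ 2 + C₁ * n + C₀))
      (C₃ * powerSum (fun n => n * (n * (n * c n))) u + C₂ * powerSum (fun n => n * (n * c n)) u +
        C₁ * powerSum (fun n => n * c n) u + C₀ * powerSum c u) := by
  have s0 := (h.summable hu).hasSum.mul_left C₀
  have s1 := (h.natCast_mul.summable hu).hasSum.mul_left C₁
  have s2 := (h.natCast_mul.natCast_mul.summable hu).hasSum.mul_left C₂
  have s3 := (h.natCast_mul.natCast_mul.natCast_mul.summable hu).hasSum.mul_left C₃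
  refine (((s3.add s2).add s1).add s0).congr_fun fun n => ?_
  ring

lemma seven_div_forty_lt {k : ℝ} (hk0 : (√41 - 5) / 8 < k) : 7 / 40 < k := by
  have : (6.4 : ℝ) ≤ √41 := Real.le_sqrt_of_sq_le (by norm_num)
  linarith

lemma quadratic_pos (k : ℝ) : 0 < 4 * k ^ 2 - 3 * k + 1 := by nlinarith [sq_nonneg (8 * k - 3)]

/-- The argument of the Legendre polynomials in the series. -/
noncomputable def seriesArg (k : ℝ) : ℝ :=
  (1 - 3 * k + 2 * k ^ 2 - 2 * k ^ 3) / (4 * k ^ 2 - 3 * k + 1)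

/-- The variable of the generating function in the series. -/
noncomputable def seriesVar (k : ℝ) : ℝ := -(1 + k) * (4 * k ^ 2 - 3 * k + 1) / (4 * k)

section Evaluation

variable {k : ℝ}

lemma abs_seriesArg_lt_one (hk0 : 0 < k) (hk1 : k < 1) : |seriesArg k| < 1 := by
  have hq := quadratic_pos k
  have h1 : 0 < (1 - k) ^ 3 := pow_pos (sub_pos.2 hk1) 3
  rw [seriesArg, abs_lt, lt_div_iff₀ hq, div_lt_iff₀ hq]
  constructor
  · linarith
  · have : 0 < k ^ 2 * (1 + k) := by positivity
    linarith

lemma abs_seriesVar_lt_one (hk0 : (√41 - 5) / 8 < k) (hk1 : k < 1) : |seriesVar k| < 1 := by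
  have hk : 0 < k := by linarith [seven_div_forty_lt hk0]
  have hq := quadratic_pos k
  have h : 0 < 4 * k ^ 2 + 5 * k - 1 := by
    have h1 : √41 < 8 * k + 5 := by linarith
    have h2 := (Real.sqrt_lt' (by positivity)).1 h1
    linarith
  rw [seriesVar, neg_mul, neg_div, abs_neg, abs_of_pos (by positivity),
    div_lt_one (by positivity)]
  nlinarith [mul_pos h (sub_pos.2 hk1)]

lemma brafmanRho_series (hk0 : 0 < k) (hk1 : k < 1) :
    brafmanRho (seriesArg k) (seriesVar k) = (1 - k) * (4 * k ^ 2 + 3 * k + 1) / (4 * k) := by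
  have h1 := sub_pos.2 hk1
  have h2 : seriesArg k * seriesVar k =
      -(1 + k) * (1 - 3 * k + 2 * k ^ 2 - 2 * k ^ 3) / (4 * k) := by
    have hq := (quadratic_pos k).ne'
    rw [seriesArg, seriesVar]
    generalize 4 * k ^ 2 - 3 * k + 1 = q at hq
    field_simp
  rw [brafmanRho, Real.sqrt_eq_iff_mul_self_eq_of_pos (by positivity), mul_assoc, h2, seriesVar]
  field_simp
  ring

lemma brafmanA_series (hk0 : 0 < k) (hk1 : k < 1) :
    brafmanA (seriesArg k) (seriesVar k) = k ^ 2 := by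
  rw [brafmanA, brafmanRho_series hk0 hk1, seriesVar]
  field_simp
  ring

lemma brafmanB_series (hk0 : 0 < k) (hk1 : k < 1) :
    brafmanB (seriesArg k) (seriesVar k) = -(1 - k) ^ 2 / (4 * k) := by
  rw [brafmanB, brafmanRho_series hk0 hk1, seriesVar]
  field_simp
  ring

lemma brafman_combination_eq_legendreForm (hk0 : 0 < k) (hk1 : k < 1) {x z : ℝ}
    (hx : x = seriesArg k) (hz : z = seriesVar k) :
    (4 * (k - 1) ^ 2 / (k + 1)) * (2 * k - 1) * (4 * k ^ 2 + 3 * k + 1) ^ 2 *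
        (brafmanU x z / brafmanRho x z ^ 3 +
          3 * brafmanS x z * brafmanV x z / brafmanRho x z ^ 4 +
          brafmanW x z * (brafmanT x z / brafmanRho x z ^ 4 +
            3 * brafmanS x z ^ 2 / brafmanRho x z ^ 5)) +
      12 * (k - 1) * (2 * k - 1) * (16 * k ^ 4 + k ^ 2 - 1) *
        (brafmanV x z / brafmanRho x z ^ 2 + brafmanW x z * brafmanS x z / brafmanRho x z ^ 3) +
      (288 * k ^ 6 - 400 * k ^ 5 + 102 * k ^ 4 + 97 * k ^ 3 - 93 * k ^ 2 + 47 * k - 9) *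
        (brafmanW x z / brafmanRho x z) +
      2 * (32 * k ^ 6 - 44 * k ^ 5 + 9 * k ^ 4 + 16 * k ^ 3 - 14 * k ^ 2 + 6 * k - 1) *
        (ellF (brafmanA x z) * ellF (brafmanB x z)) =
      4 * k * (4 * k ^ 2 - 3 * k + 1) * legendreForm k := by
  subst hx hz
  simp only [brafmanU, brafmanV, brafmanW, brafmanT, brafmanS, brafmanA_series hk0 hk1,
    brafmanB_series hk0 hk1, brafmanRho_series hk0 hk1, legendreForm]
  generalize ellF (-(1 - k) ^ 2 / (4 * k)) = F₂
  generalize ellP (-(1 - k) ^ 2 / (4 * k)) = P₂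
  generalize ellF (k ^ 2) = F₁
  generalize ellP (k ^ 2) = P₁
  have h1 : 1 - k ≠ 0 := (sub_pos.2 hk1).ne'
  have h2 : k - 1 ≠ 0 := (sub_neg.2 hk1).ne
  have h3 : 4 * k ^ 2 + 3 * k + 1 ≠ 0 := by positivity
  field_simp
  ring

lemma centralBinom_sq_mul_div_pow (n : ℕ) (z : ℝ) :
    ((2 * n).choose n : ℝ) ^ 2 * (z / 16) ^ n = ellCoeff n * z ^ n := by
  rw [ellCoeff, halfBinom, Nat.centralBinom_eq_two_mul_choose, div_pow, div_pow, ← pow_mul,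
    mul_comm n 2, pow_mul]
  norm_num
  ring

end Evaluation

theorem stmt5 (k : ℝ) (hk0 : (Real.sqrt 41 - 5) / 8 < k) (hk1 : k < 1) :
    Tendsto (fun N => ∑ n ∈ Finset.range N,
      ((2 * n).choose n : ℝ) ^ 2 *
        legendreP n ((1 - 3 * k + 2 * k ^ 2 - 2 * k ^ 3) / (4 * k ^ 2 - 3 * k + 1)) *
        (-(1 + k) * (4 * k ^ 2 - 3 * k + 1) / (64 * k)) ^ n *
        ((4 * (k - 1) ^ 2 / (k + 1)) * (2 * k - 1) * (4 * k ^ 2 + 3 * k + 1) ^ 2 * (n : ℝ) ^ 3 +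
         12 * (k - 1) * (2 * k - 1) * (16 * k ^ 4 + k ^ 2 - 1) * (n : ℝ) ^ 2 +
         (288 * k ^ 6 - 400 * k ^ 5 + 102 * k ^ 4 + 97 * k ^ 3 - 93 * k ^ 2 + 47 * k - 9) * (n : ℝ) +
         2 * (32 * k ^ 6 - 44 * k ^ 5 + 9 * k ^ 4 + 16 * k ^ 3 - 14 * k ^ 2 + 6 * k - 1)))
      atTop (nhds (8 * k ^ ((3 : ℝ) / 2) * (4 * k ^ 2 - 3 * k + 1) / π)) := by
  have hk' := seven_div_forty_lt hk0
  have hk : 0 < k := by linarith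
  have hx := abs_seriesArg_lt_one hk hk1
  have hz := abs_seriesVar_lt_one hk0 hk1
  have hval : 4 * k * (4 * k ^ 2 - 3 * k + 1) * (2 * √k / π) =
      8 * k ^ ((3 : ℝ) / 2) * (4 * k ^ 2 - 3 * k + 1) / π := by
    rw [show (3 : ℝ) / 2 = 1 + 1 / 2 by norm_num, Real.rpow_add hk, Real.rpow_one,
      ← Real.sqrt_eq_rpow]
    ring
  have h := ((unitDiscSummable_ellCoeff_mul_legendreP hx).hasSum_mul_cubic hz
    ((4 * (k - 1) ^ 2 / (k + 1)) * (2 * k - 1) * (4 * k ^ 2 + 3 * k + 1) ^ 2)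
    (12 * (k - 1) * (2 * k - 1) * (16 * k ^ 4 + k ^ 2 - 1))
    (288 * k ^ 6 - 400 * k ^ 5 + 102 * k ^ 4 + 97 * k ^ 3 - 93 * k ^ 2 + 47 * k - 9)
    (2 * (32 * k ^ 6 - 44 * k ^ 5 + 9 * k ^ 4 + 16 * k ^ 3 - 14 * k ^ 2 + 6 * k - 1)))
  rw [powerSum_ellCoeff_mul_legendreP hx hz, powerSum_natCast_mul_brafman hx hz,
    powerSum_natCast_mul_natCast_mul_brafman hx hz,
    powerSum_natCast_mul_natCast_mul_natCast_mul_brafman hx hz,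
    brafman_combination_eq_legendreForm hk hk1 rfl rfl, legendreForm_eq hk' hk1, hval] at h
  refine h.tendsto_sum_nat.congr fun N => Finset.sum_congr rfl fun n _ => ?_
  have hn := centralBinom_sq_mul_div_pow n (seriesVar k)
  have hz16 : seriesVar k / 16 = -(1 + k) * (4 * k ^ 2 - 3 * k + 1) / (64 * k) := by
    rw [seriesVar]
    field_simp
    ring
  rw [← seriesArg, ← hz16, mul_right_comm (ellCoeff n), ← hn]
  ring
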